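/- Let κ be a kernel on X satisfying the energy principle and let f = ψ + U^{ϑ⁺} − U^{ϑ⁻} be an external field, A ⊆ X. Then w_f(A) > −∞; consequently, the condition −∞ < w_f(A) < ∞ is equivalent to w_f(A) < ∞, which in turn holds if and only if cap_*({x ∈ A : ψ(x) < ∞}) > 0. -/

import Mathlib

open MeasureTheory Topology Filter Set ENNReal

noncomputable section

namespace GaussVar

variable {X : Type*} [TopologicalSpace X] [MeasurableSpace X]

/-- A (positive) Radon measure: a regular Borel measure. -/
def IsRadon (μ : Measure X) : Prop := μ.Regular

/-- The mutual energy `I(μ,ν) = ∬ κ(x,y) d(μ⊗ν)(x,y)`. -/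
def mutualEnergy (κ : X → X → ℝ≥0∞) (μ ν : Measure X) : ℝ≥0∞ :=
  ∫⁻ p : X × X, κ p.1 p.2 ∂(μ.prod ν)

/-- The energy `I(μ) := I(μ,μ)`. -/
def energy (κ : X → X → ℝ≥0∞) (μ : Measure X) : ℝ≥0∞ := mutualEnergy κ μ μ

/-- Membership in the cone `E⁺` of Radon measures with finite energy. -/
def memEplus (κ : X → X → ℝ≥0∞) (μ : Measure X) : Prop :=
  IsRadon μ ∧ energy κ μ < ⊤

/-- A kernel: symmetric and lower semicontinuous with values in `[0,∞]`. -/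
def IsKernel (κ : X → X → ℝ≥0∞) : Prop :=
  (∀ x y, κ x y = κ y x) ∧ LowerSemicontinuous (fun p : X × X => κ p.1 p.2)

/-- The strong (energy) metric `d(μ,ν) := (I(μ)+I(ν)−2I(μ,ν))^{1/2}` on `E⁺`. -/
def strongDist (κ : X → X → ℝ≥0∞) (μ ν : Measure X) : ℝ :=
  Real.sqrt ((energy κ μ).toReal + (energy κ ν).toReal - 2 * (mutualEnergy κ μ ν).toReal)

/-- The energy principle (strict positive definiteness). -/
def EnergyPrinciple (κ : X → X → ℝ≥0∞) : Prop :=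
  ∀ μ ν : Measure X, memEplus κ μ → memEplus κ ν →
    2 * mutualEnergy κ μ ν ≤ energy κ μ + energy κ ν ∧
      (2 * mutualEnergy κ μ ν = energy κ μ + energy κ ν → μ = ν)

/-- Convergence of a sequence in the strong metric. -/
def StrongTendstoSeq (κ : X → X → ℝ≥0∞) (μ : ℕ → Measure X) (μ₀ : Measure X) : Prop :=
  Tendsto (fun n => strongDist κ (μ n) μ₀) atTop (𝓝 0)

/-- Vague convergence of a sequence of measures. -/
def VagueTendstoSeq (μ : ℕ → Measure X) (μ₀ : Measure X) : Prop :=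
  ∀ φ : X → ℝ, Continuous φ → HasCompactSupport φ →
    Tendsto (fun n => ∫ x, φ x ∂(μ n)) atTop (𝓝 (∫ x, φ x ∂μ₀))

/-- Cauchy sequence in the strong metric. -/
def StrongCauchySeq (κ : X → X → ℝ≥0∞) (μ : ℕ → Measure X) : Prop :=
  ∀ ε : ℝ, 0 < ε → ∃ N : ℕ, ∀ m ≥ N, ∀ n ≥ N, strongDist κ (μ m) (μ n) < ε

/-- A perfect kernel: satisfies the energy principle, `(E⁺,d)` is complete, and
strong convergence implies vague convergence. -/
def IsPerfect (κ : X → X → ℝ≥0∞) : Prop :=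
  EnergyPrinciple κ ∧
    (∀ μ : ℕ → Measure X, (∀ n, memEplus κ (μ n)) → StrongCauchySeq κ μ →
        ∃ μ₀ : Measure X, memEplus κ μ₀ ∧ StrongTendstoSeq κ μ μ₀) ∧
    (∀ (μ : ℕ → Measure X) (μ₀ : Measure X), (∀ n, memEplus κ (μ n)) → memEplus κ μ₀ →
        StrongTendstoSeq κ μ μ₀ → VagueTendstoSeq μ μ₀)

/-- `μ` is concentrated on `A`: the complement of `A` is locally `μ`-negligible. -/
def Concentrated (μ : Measure X) (A : Set X) : Prop :=
  ∀ K : Set X, IsCompact K → μ (Aᶜ ∩ K) = 0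

/-- Membership in `Ĕ⁺(A)`: finite-energy Radon measures concentrated on `A`
of unit total mass. -/
def memBreve (κ : X → X → ℝ≥0∞) (A : Set X) (μ : Measure X) : Prop :=
  memEplus κ μ ∧ Concentrated μ A ∧ μ Set.univ = 1

/-- `w(A) := inf { I(μ) : μ ∈ Ĕ⁺(A) }` (with `inf ∅ = ⊤`). -/
def wcap (κ : X → X → ℝ≥0∞) (A : Set X) : ℝ≥0∞ :=
  ⨅ (μ : Measure X) (_ : memBreve κ A μ), energy κ μ

/-- The inner capacity `cap_*(A) := 1 / w(A)`. -/
def innerCap (κ : X → X → ℝ≥0∞) (A : Set X) : ℝ≥0∞ := (wcap κ A)⁻¹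

/-- The outer capacity `cap^*(E) := inf { cap_*(D) : D open, E ⊆ D }`. -/
def outerCap (κ : X → X → ℝ≥0∞) (E : Set X) : ℝ≥0∞ :=
  ⨅ (D : Set X) (_ : IsOpen D ∧ E ⊆ D), innerCap κ D

/-- `P` holds nearly everywhere (n.e.) on `A`: the exceptional subset of `A`
has inner capacity zero. -/
def NearlyEverywhere (κ : X → X → ℝ≥0∞) (A : Set X) (P : X → Prop) : Prop :=
  innerCap κ {x ∈ A | ¬ P x} = 0

/-- The potential `U^μ(x) := ∫ κ(x,y) dμ(y)`. -/
def potential (κ : X → X → ℝ≥0∞) (μ : Measure X) (x : X) : ℝ≥0∞ :=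
  ∫⁻ y, κ x y ∂μ

/-- An external field: `f = ψ + U^{ϑ⁺} − U^{ϑ⁻}` where `ψ` is lower semicontinuous,
`(−∞,∞]`-valued, positive if `X` is noncompact, and `ϑ⁺, ϑ⁻ ∈ E⁺`. -/
def IsExternalField (κ : X → X → ℝ≥0∞) (f : X → EReal) : Prop :=
  ∃ (ψ : X → EReal) (ϑp ϑm : Measure X),
    LowerSemicontinuous ψ ∧ (∀ x, ψ x ≠ ⊥) ∧ (¬ CompactSpace X → ∀ x, 0 ≤ ψ x) ∧
    memEplus κ ϑp ∧ memEplus κ ϑm ∧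
    ∀ x, f x = ψ x + (potential κ ϑp x : EReal) - (potential κ ϑm x : EReal)

/-- `f` is `μ`-integrable (as an extended-real-valued function). -/
def FieldIntegrable (f : X → EReal) (μ : Measure X) : Prop :=
  Integrable (fun x => (f x).toReal) μ ∧ (∀ᵐ x ∂μ, f x ≠ ⊤ ∧ f x ≠ ⊥)

/-- `∫ f dμ` for an a.e.-finite integrable field. -/
def fieldIntegral (f : X → EReal) (μ : Measure X) : ℝ := ∫ x, (f x).toReal ∂μ

/-- The Gauss functional `I_f(μ) := I(μ) + 2 ∫ f dμ`. -/
def gaussI (κ : X → X → ℝ≥0∞) (f : X → EReal) (μ : Measure X) : ℝ :=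
  (energy κ μ).toReal + 2 * fieldIntegral f μ

/-- Membership in `Ĕ⁺_f(A)`. -/
def Admissible (κ : X → X → ℝ≥0∞) (A : Set X) (f : X → EReal) (μ : Measure X) : Prop :=
  memBreve κ A μ ∧ FieldIntegrable f μ

/-- `w_f(A) := inf { I_f(μ) : μ ∈ Ĕ⁺_f(A) }` (with `inf ∅ = ⊤`). -/
def wf (κ : X → X → ℝ≥0∞) (A : Set X) (f : X → EReal) : EReal :=
  ⨅ (μ : Measure X) (_ : Admissible κ A f μ), ((gaussI κ f μ : ℝ) : EReal)

/-- `l` is a solution of the inner Gauss variational problem for `(A,f)`. -/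
def IsSolution (κ : X → X → ℝ≥0∞) (A : Set X) (f : X → EReal) (l : Measure X) : Prop :=
  Admissible κ A f l ∧ ((gaussI κ f l : ℝ) : EReal) = wf κ A f

/-- The `f`-weighted potential `U_f^μ := U^μ + f`. -/
def wPotential (κ : X → X → ℝ≥0∞) (f : X → EReal) (μ : Measure X) (x : X) : EReal :=
  (potential κ μ x : EReal) + f x

/-- `∫ U_f^μ dμ`, the weighted equilibrium constant of a solution. -/
def wConst (κ : X → X → ℝ≥0∞) (f : X → EReal) (μ : Measure X) : ℝ :=
  ∫ x, (wPotential κ f μ x).toReal ∂μ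

/-- The cone `E⁺(A)` is closed in the strong metric. -/
def StrongClosedEplusOn (κ : X → X → ℝ≥0∞) (A : Set X) : Prop :=
  ∀ (μ : ℕ → Measure X) (μ₀ : Measure X),
    (∀ n, memEplus κ (μ n) ∧ Concentrated (μ n) A) →
    memEplus κ μ₀ → StrongTendstoSeq κ μ μ₀ → Concentrated μ₀ A

/-- Frostman's (first) maximum principle. -/
def FrostmanMax (κ : X → X → ℝ≥0∞) : Prop :=
  ∀ μ : Measure X, memEplus κ μ →
    (∀ x : X, (∀ U : Set X, IsOpen U → x ∈ U → 0 < μ U) → potential κ μ x ≤ 1) →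
    ∀ x : X, potential κ μ x ≤ 1

/-- The domination (second maximum) principle. -/
def DominationPrinciple (κ : X → X → ℝ≥0∞) : Prop :=
  ∀ μ ν : Measure X, memEplus κ μ → memEplus κ ν →
    (∀ᵐ x ∂μ, potential κ μ x ≤ potential κ ν x) →
    ∀ x : X, potential κ μ x ≤ potential κ ν x

/-- `β` is the inner balayage of `ζ` onto `A`: `β ∈ E⁺(A)` and `U^β = U^ζ` n.e. on `A`. -/
def IsInnerBalayage (κ : X → X → ℝ≥0∞) (A : Set X) (ζ β : Measure X) : Prop :=
  memEplus κ β ∧ Concentrated β A ∧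
    NearlyEverywhere κ A (fun x => potential κ β x = potential κ ζ x)

/-- `γ` is the inner capacitary measure of `A`: `γ ∈ E⁺(A)` and `U^γ = 1` n.e. on `A`. -/
def IsCapacitaryMeasure (κ : X → X → ℝ≥0∞) (A : Set X) (γ : Measure X) : Prop :=
  memEplus κ γ ∧ Concentrated γ A ∧
    NearlyEverywhere κ A (fun x => potential κ γ x = 1)

/-- `A` is quasiclosed: approximable in outer capacity by closed sets. -/
def Quasiclosed (κ : X → X → ℝ≥0∞) (A : Set X) : Prop :=
  ∀ ε : ℝ≥0∞, 0 < ε → ∃ F : Set X, IsClosed F ∧ outerCap κ (symmDiff A F) < ε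

/-- `A` is quasicompact: approximable in outer capacity by compact sets. -/
def Quasicompact (κ : X → X → ℝ≥0∞) (A : Set X) : Prop :=
  ∀ ε : ℝ≥0∞, 0 < ε → ∃ K : Set X, IsCompact K ∧ outerCap κ (symmDiff A K) < ε


/-- A Radon measure is `τ`-additive on directed families of open sets. -/
theorem measure_iUnion_le_of_directed_isOpen {Y ι : Type*} [TopologicalSpace Y]
    [MeasurableSpace Y] [Nonempty ι] (μ : Measure Y) [μ.Regular] {U : ι → Set Y}
    (hU : ∀ i, IsOpen (U i)) (hd : Directed (· ⊆ ·) U) :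
    μ (⋃ i, U i) ≤ ⨆ i, μ (U i) := by
  rw [(isOpen_iUnion hU).measure_eq_iSup_isCompact]
  refine iSup₂_le fun K hK => iSup_le fun hKc => ?_
  obtain ⟨i, hi⟩ := hKc.elim_directed_cover U hU hK hd
  exact (measure_mono hi).trans (le_iSup (fun i => μ (U i)) i)

/-- The staircase `∑_{k < N} ε 1_{(k+1)ε < v}` approximating `v` from below. -/
def staircase (ε : ℝ≥0∞) (N : ℕ) (v : ℝ≥0∞) : ℝ≥0∞ :=
  ∑ k ∈ Finset.range N, (Ioi ((k + 1 : ℕ) * ε)).indicator (fun _ => ε) v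

theorem staircase_le_min (ε : ℝ≥0∞) (N : ℕ) (v : ℝ≥0∞) :
    staircase ε N v ≤ min v (N * ε) := by
  induction N with
  | zero => simp [staircase]
  | succ N ih =>
    rw [staircase, Finset.sum_range_succ, ← staircase]
    by_cases h : ((N + 1 : ℕ) : ℝ≥0∞) * ε < v
    · rw [min_eq_right h.le, indicator_of_mem (mem_Ioi.2 h)]
      push_cast
      rw [add_mul, one_mul]
      gcongr
      exact ih.trans (min_le_right _ _)
    · rw [indicator_of_notMem (by simpa using h), add_zero]
      refine ih.trans (min_le_min_left _ ?_)
      gcongr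
      simp

theorem min_le_staircase_add (ε : ℝ≥0∞) (N : ℕ) (v : ℝ≥0∞) :
    min v ((N + 1 : ℕ) * ε) ≤ staircase ε N v + ε := by
  induction N with
  | zero => simp [staircase]
  | succ N ih =>
    rw [staircase, Finset.sum_range_succ, ← staircase]
    by_cases h : ((N + 1 : ℕ) : ℝ≥0∞) * ε < v
    · rw [min_eq_right h.le] at ih
      rw [indicator_of_mem (mem_Ioi.2 h)]
      refine (min_le_right _ _).trans ?_
      rw [Nat.cast_add_one, add_mul, one_mul]
      gcongr
    · rw [indicator_of_notMem (by simpa using h), add_zero]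
      rw [min_eq_left (not_lt.1 h)] at ih
      exact (min_le_left _ _).trans ih

theorem le_liminf_staircase (v : ℝ≥0∞) :
    v ≤ liminf (fun n : ℕ => staircase ((n + 1 : ℕ) : ℝ≥0∞)⁻¹ ((n + 1) * (n + 1)) v) atTop := by
  have h1 : Tendsto (fun n : ℕ => ((n + 1 : ℕ) : ℝ≥0∞)) atTop (𝓝 ⊤) :=
    ENNReal.tendsto_nat_nhds_top.comp (tendsto_add_atTop_nat 1)
  have h2 : Tendsto (fun n : ℕ => min v ((n + 1 : ℕ) : ℝ≥0∞) - ((n + 1 : ℕ) : ℝ≥0∞)⁻¹)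
      atTop (𝓝 v) := by
    have h3 : Tendsto (fun n : ℕ => ((n + 1 : ℕ) : ℝ≥0∞)⁻¹) atTop (𝓝 0) := by
      simpa using (tendsto_inv_iff.2 h1)
    simpa using ENNReal.Tendsto.sub (tendsto_const_nhds.min h1) h3 (Or.inr ENNReal.zero_ne_top)
  refine h2.liminf_eq.symm.le.trans (liminf_le_liminf (Eventually.of_forall fun n => ?_))
  rw [tsub_le_iff_right]
  refine le_trans (min_le_min_left _ ?_) (min_le_staircase_add _ _ _)
  push_cast
  rw [add_mul, mul_assoc, ENNReal.mul_inv_cancel (by simp) (by finiteness), mul_one, one_mul]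
  exact le_self_add

theorem measurable_staircase (ε : ℝ≥0∞) (N : ℕ) : Measurable (staircase ε N) :=
  Finset.measurable_fun_sum _ fun _ _ => measurable_const.indicator measurableSet_Ioi

/-- Integration against a Radon measure commutes with directed suprema of lower semicontinuous
functions. -/
theorem lintegral_iSup_le_of_directed_lsc {Y ι : Type*} [TopologicalSpace Y]
    [MeasurableSpace Y] [BorelSpace Y] [Nonempty ι] (μ : Measure Y) [μ.Regular]
    {g : ι → Y → ℝ≥0∞} (hg : ∀ i, LowerSemicontinuous (g i)) (hd : Directed (· ≤ ·) g) :
    ∫⁻ y, ⨆ i, g i y ∂μ ≤ ⨆ i, ∫⁻ y, g i y ∂μ := by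
  have hlsc : LowerSemicontinuous fun y => ⨆ i, g i y := lowerSemicontinuous_iSup hg
  have key : ∀ (ε : ℝ≥0∞) (N : ℕ) (h : Y → ℝ≥0∞), LowerSemicontinuous h →
      ∫⁻ y, staircase ε N (h y) ∂μ =
        ∑ k ∈ Finset.range N, ε * μ (h ⁻¹' Ioi ((k + 1 : ℕ) * ε)) := by
    intro ε N h hh
    simp only [staircase]
    rw [lintegral_finsetSum]
    · refine Finset.sum_congr rfl fun k _ => ?_
      exact lintegral_indicator_const (hh.isOpen_preimage ((k + 1 : ℕ) * ε)).measurableSet ε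
    · intro k _
      exact (measurable_const.indicator measurableSet_Ioi).comp hh.measurable
  have step : ∀ (ε : ℝ≥0∞) (N : ℕ),
      ∫⁻ y, staircase ε N (⨆ i, g i y) ∂μ ≤ ⨆ i, ∫⁻ y, g i y ∂μ := by
    intro ε N
    rw [key ε N _ hlsc]
    have hpre : ∀ t : ℝ≥0∞, (fun y => ⨆ i, g i y) ⁻¹' Ioi t = ⋃ i, g i ⁻¹' Ioi t := by
      intro t
      ext y
      simp [lt_iSup_iff]
    calc ∑ k ∈ Finset.range N, ε * μ ((fun y => ⨆ i, g i y) ⁻¹' Ioi ((k + 1 : ℕ) * ε))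
        ≤ ∑ k ∈ Finset.range N, ⨆ i, ε * μ (g i ⁻¹' Ioi ((k + 1 : ℕ) * ε)) := by
          gcongr with k _
          rw [hpre, ← ENNReal.mul_iSup]
          gcongr
          refine measure_iUnion_le_of_directed_isOpen μ (fun i => (hg i).isOpen_preimage _)
            (hd.mono_comp (· ≤ ·) (g := fun h : Y → ℝ≥0∞ => h ⁻¹' Ioi ((k + 1 : ℕ) * ε)) ?_)
          intro a b hab y hy
          exact lt_of_lt_of_le hy (hab y)
      _ = ⨆ i, ∑ k ∈ Finset.range N, ε * μ (g i ⁻¹' Ioi ((k + 1 : ℕ) * ε)) := by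
          refine ENNReal.finsetSum_iSup fun i j => (hd i j).imp fun l hl k => ?_
          constructor
          · gcongr ε * μ ?_
            exact fun y hy => lt_of_lt_of_le hy (hl.1 y)
          · gcongr ε * μ ?_
            exact fun y hy => lt_of_lt_of_le hy (hl.2 y)
      _ ≤ ⨆ i, ∫⁻ y, g i y ∂μ := by
          refine iSup_mono fun i => ?_
          rw [← key ε N _ (hg i)]
          exact lintegral_mono fun y => (staircase_le_min _ _ _).trans (min_le_left _ _)
  calc ∫⁻ y, ⨆ i, g i y ∂μ
      ≤ ∫⁻ y, liminf (fun n : ℕ => staircase ((n + 1 : ℕ) : ℝ≥0∞)⁻¹ ((n + 1) * (n + 1))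
          (⨆ i, g i y)) atTop ∂μ := lintegral_mono fun y => le_liminf_staircase _
    _ ≤ liminf (fun n : ℕ => ∫⁻ y, staircase ((n + 1 : ℕ) : ℝ≥0∞)⁻¹ ((n + 1) * (n + 1))
          (⨆ i, g i y) ∂μ) atTop :=
        lintegral_liminf_le fun n => (measurable_staircase _ _).comp hlsc.measurable
    _ ≤ liminf (fun _ : ℕ => ⨆ i, ∫⁻ y, g i y ∂μ) atTop :=
        liminf_le_liminf (Eventually.of_forall fun n => step _ _)
    _ = ⨆ i, ∫⁻ y, g i y ∂μ := liminf_const _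

/-- Minorants of `κ` which are measurable for the product `σ`-algebra and live over a set
of finite `ϑ`-measure. -/
structure IsMinorant (κ : X → X → ℝ≥0∞) (ϑ : Measure X) (s : X × X → ℝ≥0∞) : Prop where
  measurable : Measurable s
  le : ∀ x y, s (x, y) ≤ κ x y
  eventually_le : ∀ x₀, ∀ᶠ x in 𝓝 x₀, ∀ y, s (x₀, y) ≤ s (x, y)
  lsc : ∀ x, LowerSemicontinuous fun y => s (x, y)
  support : ∃ W, MeasurableSet W ∧ ϑ W < ⊤ ∧ ∀ x, ∀ y ∉ W, s (x, y) = 0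

theorem IsMinorant.zero (κ : X → X → ℝ≥0∞) (ϑ : Measure X) : IsMinorant κ ϑ 0 where
  measurable := measurable_const
  le _ _ := zero_le
  eventually_le _ := Eventually.of_forall fun _ _ => le_rfl
  lsc _ := lowerSemicontinuous_const
  support := ⟨∅, MeasurableSet.empty, by simp, fun _ _ _ => rfl⟩

theorem IsMinorant.sup {κ : X → X → ℝ≥0∞} {ϑ : Measure X} {s t : X × X → ℝ≥0∞}
    (hs : IsMinorant κ ϑ s) (ht : IsMinorant κ ϑ t) : IsMinorant κ ϑ (s ⊔ t) where
  measurable := hs.measurable.sup ht.measurable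
  le x y := sup_le (hs.le x y) (ht.le x y)
  eventually_le x₀ := by
    filter_upwards [hs.eventually_le x₀, ht.eventually_le x₀] with x h1 h2 y
    exact sup_le_sup (h1 y) (h2 y)
  lsc x := (hs.lsc x).sup (ht.lsc x)
  support := by
    obtain ⟨W, hW, hWϑ, h⟩ := hs.support
    obtain ⟨W', hW', hWϑ', h'⟩ := ht.support
    refine ⟨W ∪ W', hW.union hW', (measure_union_le _ _).trans_lt
      (ENNReal.add_lt_top.2 ⟨hWϑ, hWϑ'⟩),
      fun x y hy => ?_⟩
    rw [mem_union, not_or] at hy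
    simp [h x y hy.1, h' x y hy.2]

theorem IsMinorant.lowerSemicontinuous_lintegral {κ : X → X → ℝ≥0∞} {ϑ : Measure X}
    {s : X × X → ℝ≥0∞} (hs : IsMinorant κ ϑ s) :
    LowerSemicontinuous fun x => ∫⁻ y, s (x, y) ∂ϑ := by
  intro x₀ c hc
  filter_upwards [hs.eventually_le x₀] with x hx
  exact lt_of_lt_of_le hc (lintegral_mono hx)

theorem IsMinorant.lintegral_lintegral_le {κ : X → X → ℝ≥0∞} (hsymm : ∀ x y, κ x y = κ y x)
    {ϑ : Measure X} {s : X × X → ℝ≥0∞} (hs : IsMinorant κ ϑ s) (μ : Measure X) [SFinite μ] :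
    ∫⁻ x, ∫⁻ y, s (x, y) ∂ϑ ∂μ ≤ mutualEnergy κ ϑ μ := by
  obtain ⟨W, hW, hWϑ, hsW⟩ := hs.support
  have : IsFiniteMeasure (ϑ.restrict W) := ⟨by simpa using hWϑ⟩
  calc ∫⁻ x, ∫⁻ y, s (x, y) ∂ϑ ∂μ
      = ∫⁻ x, ∫⁻ y, s (x, y) ∂(ϑ.restrict W) ∂μ := by
        refine lintegral_congr fun x => ?_
        rw [← lintegral_indicator hW]
        refine lintegral_congr fun y => ?_
        by_cases hy : y ∈ W
        · rw [indicator_of_mem hy]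
        · rw [indicator_of_notMem hy, hsW x y hy]
    _ = ∫⁻ y, ∫⁻ x, s (x, y) ∂μ ∂(ϑ.restrict W) :=
        lintegral_lintegral_swap (f := fun x y => s (x, y)) hs.measurable.aemeasurable
    _ ≤ ∫⁻ y, ∫⁻ x, s (x, y) ∂μ ∂ϑ := lintegral_mono' Measure.restrict_le_self le_rfl
    _ = ∫⁻ p, s p.swap ∂(ϑ.prod μ) :=
        (lintegral_prod _ (hs.measurable.comp measurable_swap).aemeasurable).symm
    _ ≤ mutualEnergy κ ϑ μ :=
        lintegral_mono fun p => (hs.le p.2 p.1).trans (hsymm _ _).le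

section Tonelli

variable [BorelSpace X]

theorem isMinorant_indicator {κ : X → X → ℝ≥0∞} {ϑ : Measure X} {U V : Set X} (hU : IsOpen U)
    (hV : IsOpen V) (hVϑ : ϑ V < ⊤) {c : ℝ≥0∞} (hc : ∀ x ∈ U, ∀ y ∈ V, c ≤ κ x y) :
    IsMinorant κ ϑ ((U ×ˢ V).indicator fun _ => c) where
  measurable := measurable_const.indicator (hU.measurableSet.prod hV.measurableSet)
  le x y := by
    by_cases h : (x, y) ∈ U ×ˢ V
    · rw [indicator_of_mem h]
      exact hc x h.1 y h.2
    · rw [indicator_of_notMem h]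
      exact zero_le
  eventually_le x₀ := by
    by_cases h : x₀ ∈ U
    · filter_upwards [hU.mem_nhds h] with x hx y
      by_cases hy : y ∈ V <;> simp [h, hx, hy]
    · exact Eventually.of_forall fun x y => by simp [h]
  lsc x := by
    by_cases h : x ∈ U
    · have : (fun y => (U ×ˢ V).indicator (fun _ => c) (x, y)) = V.indicator fun _ => c := by
        ext y
        by_cases hy : y ∈ V <;> simp [h, hy]
      rw [this]
      exact hV.lowerSemicontinuous_indicator zero_le
    · simpa [h] using lowerSemicontinuous_const
  support := ⟨V, hV.measurableSet, hVϑ, fun x y hy => by simp [hy]⟩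

theorem iSup_isMinorant_eq {κ : X → X → ℝ≥0∞} (hκ : LowerSemicontinuous fun p : X × X => κ p.1 p.2)
    (ϑ : Measure X) [IsLocallyFiniteMeasure ϑ] (x y : X) :
    ⨆ s : {s // IsMinorant κ ϑ s}, s.1 (x, y) = κ x y := by
  refine le_antisymm (iSup_le fun s => s.2.le x y) (le_of_forall_lt fun c hc => ?_)
  obtain ⟨d, hcd, hd⟩ := exists_between hc
  obtain ⟨U, hU, V, hV, hUV⟩ := mem_nhds_prod_iff.1 (hκ (x, y) d hd)
  obtain ⟨V', hyV', hV', hV'ϑ⟩ := ϑ.exists_isOpen_measure_lt_top y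
  have hmin : IsMinorant κ ϑ ((interior U ×ˢ (interior V ∩ V')).indicator fun _ => d) :=
    isMinorant_indicator isOpen_interior (isOpen_interior.inter hV')
      ((measure_mono inter_subset_right).trans_lt hV'ϑ) fun a ha b hb =>
        le_of_lt (hUV (mk_mem_prod (interior_subset ha) (interior_subset hb.1)))
  refine hcd.trans_le (le_trans ?_
    (le_iSup (fun s : {s // IsMinorant κ ϑ s} => s.1 (x, y)) ⟨_, hmin⟩))
  have hxy : (x, y) ∈ interior U ×ˢ (interior V ∩ V') :=
    mk_mem_prod (mem_interior_iff_mem_nhds.2 hU) ⟨mem_interior_iff_mem_nhds.2 hV, hyV'⟩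
  exact (indicator_of_mem hxy fun _ => d).ge

theorem potential_eq_iSup {κ : X → X → ℝ≥0∞}
    (hκ : LowerSemicontinuous fun p : X × X => κ p.1 p.2) (ϑ : Measure X) [ϑ.Regular]
    [IsLocallyFiniteMeasure ϑ] (x : X) :
    potential κ ϑ x = ⨆ s : {s // IsMinorant κ ϑ s}, ∫⁻ y, s.1 (x, y) ∂ϑ := by
  have : Nonempty {s // IsMinorant κ ϑ s} := ⟨⟨0, .zero κ ϑ⟩⟩
  refine le_antisymm ?_ (iSup_le fun s => lintegral_mono fun y => s.2.le x y)
  simp only [potential, ← iSup_isMinorant_eq hκ ϑ]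
  refine lintegral_iSup_le_of_directed_lsc ϑ (fun s => s.2.lsc x) fun s t => ?_
  exact ⟨⟨s.1 ⊔ t.1, s.2.sup t.2⟩, fun y => le_sup_left (a := s.1 (x, y)),
    fun y => le_sup_right (b := t.1 (x, y))⟩

theorem lowerSemicontinuous_potential {κ : X → X → ℝ≥0∞}
    (hκ : LowerSemicontinuous fun p : X × X => κ p.1 p.2) (ϑ : Measure X) [ϑ.Regular]
    [IsLocallyFiniteMeasure ϑ] : LowerSemicontinuous (potential κ ϑ) := by
  have : potential κ ϑ = fun x => ⨆ s : {s // IsMinorant κ ϑ s}, ∫⁻ y, s.1 (x, y) ∂ϑ :=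
    funext (potential_eq_iSup hκ ϑ)
  rw [this]
  exact lowerSemicontinuous_iSup fun s => s.2.lowerSemicontinuous_lintegral

theorem lintegral_potential_le {κ : X → X → ℝ≥0∞} (hκ : IsKernel κ) (ϑ μ : Measure X)
    [ϑ.Regular] [IsLocallyFiniteMeasure ϑ] [μ.Regular] [SFinite μ] :
    ∫⁻ x, potential κ ϑ x ∂μ ≤ mutualEnergy κ ϑ μ := by
  have : Nonempty {s // IsMinorant κ ϑ s} := ⟨⟨0, .zero κ ϑ⟩⟩
  simp only [potential_eq_iSup hκ.2 ϑ]
  refine (lintegral_iSup_le_of_directed_lsc μ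
    (fun s => s.2.lowerSemicontinuous_lintegral) fun s t => ?_).trans
    (iSup_le fun s => s.2.lintegral_lintegral_le hκ.1 μ)
  exact ⟨⟨s.1 ⊔ t.1, s.2.sup t.2⟩,
    fun x => lintegral_mono fun y => le_sup_left (a := s.1 (x, y)),
    fun x => lintegral_mono fun y => le_sup_right (b := t.1 (x, y))⟩

theorem memEplus_smul_restrict [R1Space X] {κ : X → X → ℝ≥0∞} {μ : Measure X}
    [IsFiniteMeasure μ] (hμ : memEplus κ μ) (E : Set X) {c : ℝ≥0∞} (hc : c ≠ ⊤) :
    memEplus κ (c • μ.restrict E) := by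
  have := hμ.1
  unfold IsRadon at this
  have : (μ.restrict E).Regular := Measure.Regular.restrict_of_measure_ne_top (by finiteness)
  refine ⟨Measure.Regular.smul hc, ?_⟩
  calc energy κ (c • μ.restrict E)
      = c * (c * energy κ (μ.restrict E)) := by
        simp only [energy, mutualEnergy, Measure.prod_smul_left, Measure.prod_smul_right,
          lintegral_smul_measure, smul_eq_mul]
    _ ≤ c * (c * energy κ μ) := by
        gcongr
        exact lintegral_mono' (Measure.prod_mono Measure.restrict_le_self
          Measure.restrict_le_self) le_rfl
    _ < ⊤ := ENNReal.mul_lt_top hc.lt_top (ENNReal.mul_lt_top hc.lt_top hμ.2)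

variable [LocallyCompactSpace X]

theorem two_mul_lintegral_potential_le {κ : X → X → ℝ≥0∞} (hκ : IsKernel κ)
    (hen : EnergyPrinciple κ) {ϑ μ : Measure X} (hϑ : memEplus κ ϑ) (hμ : memEplus κ μ)
    [SFinite μ] : 2 * ∫⁻ x, potential κ ϑ x ∂μ ≤ energy κ ϑ + energy κ μ := by
  have := hϑ.1
  have := hμ.1
  unfold IsRadon at *
  refine le_trans ?_ (hen ϑ μ hϑ hμ).1
  gcongr
  exact lintegral_potential_le hκ ϑ μ

theorem lintegral_potential_lt_top {κ : X → X → ℝ≥0∞} (hκ : IsKernel κ)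
    (hen : EnergyPrinciple κ) {ϑ μ : Measure X} (hϑ : memEplus κ ϑ) (hμ : memEplus κ μ)
    [SFinite μ] : ∫⁻ x, potential κ ϑ x ∂μ < ⊤ := by
  have h := (two_mul_lintegral_potential_le hκ hen hϑ hμ).trans_lt
    (ENNReal.add_lt_top.2 ⟨hϑ.2, hμ.2⟩)
  exact lt_of_le_of_lt (by rw [two_mul]; exact le_self_add) h

theorem measurable_potential {κ : X → X → ℝ≥0∞} (hκ : IsKernel κ) {ϑ : Measure X}
    (hϑ : memEplus κ ϑ) : Measurable (potential κ ϑ) := by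
  have := hϑ.1
  unfold IsRadon at this
  exact (lowerSemicontinuous_potential hκ.2 ϑ).measurable

theorem integrable_toReal_potential {κ : X → X → ℝ≥0∞} (hκ : IsKernel κ)
    (hen : EnergyPrinciple κ) {ϑ μ : Measure X} (hϑ : memEplus κ ϑ) (hμ : memEplus κ μ)
    [SFinite μ] : Integrable (fun x => (potential κ ϑ x).toReal) μ :=
  integrable_toReal_of_lintegral_ne_top (measurable_potential hκ hϑ).aemeasurable
    (lintegral_potential_lt_top hκ hen hϑ hμ).ne

theorem ae_potential_ne_top {κ : X → X → ℝ≥0∞} (hκ : IsKernel κ)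
    (hen : EnergyPrinciple κ) {ϑ μ : Measure X} (hϑ : memEplus κ ϑ) (hμ : memEplus κ μ)
    [SFinite μ] : ∀ᵐ x ∂μ, potential κ ϑ x ≠ ⊤ :=
  (ae_lt_top (measurable_potential hκ hϑ) (lintegral_potential_lt_top hκ hen hϑ hμ).ne).mono
    fun _ => LT.lt.ne

theorem two_mul_integral_toReal_potential_le {κ : X → X → ℝ≥0∞} (hκ : IsKernel κ)
    (hen : EnergyPrinciple κ) {ϑ μ : Measure X} (hϑ : memEplus κ ϑ) (hμ : memEplus κ μ)
    [SFinite μ] :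
    2 * ∫ x, (potential κ ϑ x).toReal ∂μ ≤ (energy κ ϑ).toReal + (energy κ μ).toReal := by
  rw [integral_toReal (measurable_potential hκ hϑ).aemeasurable
    ((ae_potential_ne_top hκ hen hϑ hμ).mono fun _ => Ne.lt_top),
    ← ENNReal.toReal_add hϑ.2.ne hμ.2.ne, ← ENNReal.toReal_ofNat, ← ENNReal.toReal_mul]
  exact ENNReal.toReal_mono (ENNReal.add_lt_top.2 ⟨hϑ.2, hμ.2⟩).ne
    (two_mul_lintegral_potential_le hκ hen hϑ hμ)

end Tonelli

theorem exists_coe_le_of_lowerSemicontinuous {Y : Type*} [TopologicalSpace Y] {ψ : Y → EReal}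
    (hψ : LowerSemicontinuous ψ) (hψbot : ∀ x, ψ x ≠ ⊥)
    (hψpos : ¬ CompactSpace Y → ∀ x, 0 ≤ ψ x) : ∃ c : ℝ, ∀ x, (c : EReal) ≤ ψ x := by
  by_cases hY : CompactSpace Y
  · rcases isEmpty_or_nonempty Y with h | h
    · exact ⟨0, fun x => h.elim x⟩
    · obtain ⟨a, -, ha⟩ := LowerSemicontinuousOn.exists_isMinOn univ_nonempty isCompact_univ
        (hψ.lowerSemicontinuousOn univ)
      obtain ⟨c, -, hc⟩ := EReal.lt_iff_exists_real_btwn.1 (bot_lt_iff_ne_bot.2 (hψbot a))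
      exact ⟨c, fun x => hc.le.trans (ha (mem_univ x))⟩
  · exact ⟨0, fun x => by simpa using hψpos hY x⟩

/-- Where `f = u + a - b` is finite and `b < ∞`, its real value is bounded below. -/
theorem sub_toReal_le_toReal {u v : EReal} {a b : ℝ≥0∞} {c : ℝ} (hc : (c : EReal) ≤ u)
    (hv : v = u + (a : EReal) - (b : EReal)) (hv_top : v ≠ ⊤) (hb : b ≠ ⊤) :
    c - b.toReal ≤ v.toReal := by
  have h : ((c - b.toReal : ℝ) : EReal) ≤ v := by
    rw [hv, EReal.coe_sub, EReal.coe_ennreal_toReal hb]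
    exact EReal.sub_le_sub (hc.trans (le_add_of_nonneg_right (EReal.coe_ennreal_nonneg a))) le_rfl
  rw [← EReal.coe_le_coe_iff, EReal.coe_toReal hv_top]
  · exact h
  · rintro rfl
    exact absurd (le_bot_iff.1 h) (EReal.coe_ne_bot _)

theorem ne_top_of_add_sub_ne {u v : EReal} {a b : ℝ≥0∞}
    (hv : v = u + (a : EReal) - (b : EReal)) (hv_top : v ≠ ⊤) (hv_bot : v ≠ ⊥) : u ≠ ⊤ := by
  rintro rfl
  rw [EReal.top_add_of_ne_bot (EReal.coe_ennreal_ne_bot a)] at hv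
  induction b with
  | top => exact hv_bot (by simpa using hv)
  | coe b => exact hv_top (by simpa using hv)

theorem stmt18 {X : Type*} [TopologicalSpace X] [T2Space X] [LocallyCompactSpace X]
    [MeasurableSpace X] [BorelSpace X]
    (κ : X → X → ℝ≥0∞) (A : Set X)
    (hker : IsKernel κ) (hen : EnergyPrinciple κ)
    (ψ : X → EReal) (ϑp ϑm : Measure X) (f : X → EReal)
    (hψ : LowerSemicontinuous ψ) (hψbot : ∀ x, ψ x ≠ ⊥)
    (hψpos : ¬ CompactSpace X → ∀ x, 0 ≤ ψ x)
    (hp : memEplus κ ϑp) (hm : memEplus κ ϑm)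
    (hf : ∀ x, f x = ψ x + (potential κ ϑp x : EReal) - (potential κ ϑm x : EReal)) :
    wf κ A f ≠ ⊥ ∧
    (wf κ A f < ⊤ ↔ innerCap κ {x ∈ A | ψ x ≠ ⊤} ≠ 0) := by
  obtain ⟨c, hc⟩ := exists_coe_le_of_lowerSemicontinuous hψ hψbot hψpos
  constructor
  · have hbound : ((2 * c - (energy κ ϑm).toReal : ℝ) : EReal) ≤ wf κ A f := by
      refine le_iInf₂ fun μ hμ => EReal.coe_le_coe_iff.2 ?_
      obtain ⟨⟨hμE, -, hμ1⟩, hf_int, hfin⟩ := hμ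
      have : IsProbabilityMeasure μ := ⟨hμ1⟩
      have hU := integrable_toReal_potential hker hen hm hμE
      have h1 := two_mul_integral_toReal_potential_le hker hen hm hμE
      have h2 : ∫ x, (c - (potential κ ϑm x).toReal) ∂μ ≤ fieldIntegral f μ := by
        refine integral_mono_ae ((integrable_const c).sub hU) hf_int ?_
        filter_upwards [hfin, ae_potential_ne_top hker hen hm hμE] with x hx hmx
        exact sub_toReal_le_toReal (hc x) (hf x) hx.1 hmx
      rw [integral_sub (integrable_const c) hU, integral_const, probReal_univ, one_smul] at h2
      unfold gaussI
      linarith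
    exact (lt_of_lt_of_le (EReal.bot_lt_coe _) hbound).ne'
  rw [innerCap, ENNReal.inv_ne_zero]
  constructor
  · intro h
    obtain ⟨μ, h⟩ := iInf_lt_iff.1 h
    obtain ⟨⟨⟨hμE, hμA, hμ1⟩, -, hfin⟩, -⟩ := iInf_lt_iff.1 h
    refine ne_top_of_le_ne_top hμE.2.ne (iInf₂_le μ ⟨hμE, fun K hK => ?_, hμ1⟩)
    have hψfin : μ {x | ¬ ψ x ≠ ⊤} = 0 :=
      ae_iff.1 (hfin.mono fun x hx => ne_top_of_add_sub_ne (hf x) hx.1 hx.2)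
    refine measure_mono_null (fun x hx => ?_) (measure_union_null (hμA K hK) hψfin)
    by_cases hxA : x ∈ A
    · exact Or.inr fun hxψ => hx.1 ⟨hxA, hxψ⟩
    · exact Or.inl ⟨hxA, hx.2⟩
  · intro h
    obtain ⟨μ, h⟩ := iInf_lt_iff.1 (lt_top_iff_ne_top.2 h)
    obtain ⟨⟨hμE, hμA, hμ1⟩, -⟩ := iInf_lt_iff.1 h
    have : IsProbabilityMeasure μ := ⟨hμ1⟩
    have hreg := hμE.1
    unfold IsRadon at hreg
    obtain ⟨K, hK, hK0⟩ := Measure.Regular.exists_isCompact_not_null.2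
      (IsProbabilityMeasure.ne_zero μ)
    obtain ⟨n, hn⟩ : ∃ n : ℕ, μ (ψ ⁻¹' Iic (n : ℝ) ∩ K) ≠ 0 := by
      by_contra! hall
      refine hK0 (measure_mono_null (fun x hx => ?_)
        (measure_union_null (hμA K hK) (measure_iUnion_null hall)))
      by_cases hxA : x ∈ {x ∈ A | ψ x ≠ ⊤}
      · obtain ⟨n, hn⟩ := exists_nat_ge (ψ x).toReal
        refine Or.inr (mem_iUnion.2 ⟨n, ?_, hx⟩)
        exact (EReal.le_coe_toReal hxA.2).trans (EReal.coe_le_coe_iff.2 hn)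
      · exact Or.inl ⟨hxA, hx⟩
    set E := ψ ⁻¹' Iic (n : ℝ) ∩ K
    have hEmeas : MeasurableSet E := (hψ.measurable measurableSet_Iic).inter hK.measurableSet
    set ν := (μ E)⁻¹ • μ.restrict E with hν
    have hνE : memEplus κ ν := memEplus_smul_restrict hμE E (ENNReal.inv_ne_top.2 hn)
    have hν1 : ν univ = 1 := by
      simp [hν, ENNReal.inv_mul_cancel hn (measure_ne_top μ E)]
    have : IsProbabilityMeasure ν := ⟨hν1⟩
    have hνA : Concentrated ν A := by
      intro K' _
      have h0 : μ.restrict E (Aᶜ ∩ K') = 0 := by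
        rw [Measure.restrict_apply' hEmeas]
        exact measure_mono_null (fun x hx => (⟨fun h => hx.1.1 h.1, hx.2.2⟩ :
          x ∈ {x ∈ A | ψ x ≠ ⊤}ᶜ ∩ K)) (hμA K hK)
      simp [hν, h0]
    have hνψ : ∀ᵐ x ∂ν, ψ x ≤ (n : ℝ) :=
      Measure.ae_smul_measure ((ae_restrict_mem hEmeas).mono fun x hx => hx.1) _
    have hνp := ae_potential_ne_top hker hen hp hνE
    have hνm := ae_potential_ne_top hker hen hm hνE
    have hψint : Integrable (fun x => (ψ x).toReal) ν := by
      refine Integrable.of_mem_Icc c n hψ.measurable.ereal_toReal.aemeasurable ?_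
      filter_upwards [hνψ] with x hx
      exact ⟨EReal.toReal_le_toReal (hc x) (EReal.coe_ne_bot c)
          (ne_top_of_le_ne_top (EReal.coe_ne_top _) hx),
        EReal.toReal_le_toReal hx (hψbot x) (EReal.coe_ne_top _)⟩
    have hfeq : ∀ᵐ x ∂ν, f x = (((ψ x).toReal + (potential κ ϑp x).toReal
        - (potential κ ϑm x).toReal : ℝ) : EReal) := by
      filter_upwards [hνψ, hνp, hνm] with x hx hpx hmx
      rw [hf x, EReal.coe_sub, EReal.coe_add,
        EReal.coe_toReal (ne_top_of_le_ne_top (EReal.coe_ne_top _) hx) (hψbot x),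
        EReal.coe_ennreal_toReal hpx, EReal.coe_ennreal_toReal hmx]
    have hadm : Admissible κ A f ν := by
      refine ⟨⟨hνE, hνA, hν1⟩, ?_, ?_⟩
      · refine ((hψint.add (integrable_toReal_potential hker hen hp hνE)).sub
          (integrable_toReal_potential hker hen hm hνE)).congr ?_
        filter_upwards [hfeq] with x hx
        rw [hx, EReal.toReal_coe]
        rfl
      · filter_upwards [hfeq] with x hx
        rw [hx]
        exact ⟨EReal.coe_ne_top _, EReal.coe_ne_bot _⟩
    exact (iInf₂_le ν hadm).trans_lt (EReal.coe_lt_top _)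

end GaussVar
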